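/- Fix s ≥ 1 and 1 ≤ k ≤ n, and let μ be the hook partition (s, 1^{k−1}). Let U_μ ∈ SVT^n((s)) be the one-row tableau whose first s−1 boxes are {1} and whose last box is {1,2,…,k}, and let SVT^n_μ((s)) be the closure of {U_μ} under all operators e_i and f_i (1 ≤ i < n). Then there is a crystal isomorphism SVT^n_μ((s)) → SSYT^n(μ), i.e., a bijection φ (with φ(0)=0) satisfying wt(φ(T)) = wt(T), φ(e_i T) = e_i φ(T) and φ(f_i T) = f_i φ(T) for all i and all T. -/

import Mathlib

open scoped Classical

noncomputable section

namespace SVTCrystal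

/-- A filling assigns to each (row, column) position (0-indexed) a finite set of entries. -/
abbrev Filling : Type := ℕ → ℕ → Finset ℕ

/-- `lam` is a partition shape with at most `n` rows. -/
def IsPartitionShape (n : ℕ) (lam : ℕ → ℕ) : Prop :=
  (∀ r, lam (r + 1) ≤ lam r) ∧ (∀ r, n ≤ r → lam r = 0)

/-- Semistandard set-valued tableau of shape `lam` with entries in `{1,…,n}`. -/
structure IsSVT (n : ℕ) (lam : ℕ → ℕ) (t : Filling) : Prop where
  boxNonempty : ∀ r c, c < lam r → (t r c).Nonempty
  emptyOutside : ∀ r c, ¬ c < lam r → t r c = ∅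
  entryBounds : ∀ r c a, a ∈ t r c → 1 ≤ a ∧ a ≤ n
  rowWeak : ∀ r c a b, a ∈ t r c → b ∈ t r (c + 1) → a ≤ b
  colStrict : ∀ r c a b, a ∈ t r c → b ∈ t (r + 1) c → a < b

/-- Semistandard Young tableau: a set-valued tableau all of whose boxes are singletons. -/
def IsSSYT (n : ℕ) (lam : ℕ → ℕ) (t : Filling) : Prop :=
  IsSVT n lam t ∧ ∀ r c, c < lam r → (t r c).card = 1

/-- The weight: `wt n lam t j` is the number of boxes of `t` containing the entry `j`. -/
def wt (n : ℕ) (lam : ℕ → ℕ) (t : Filling) (j : ℕ) : ℕ :=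
  ((Finset.range n ×ˢ Finset.range (lam 0)).filter (fun p => j ∈ t p.1 p.2)).card

/-- The excess: total number of extra entries. -/
def excess (n : ℕ) (lam : ℕ → ℕ) (t : Filling) : ℕ :=
  ∑ p ∈ Finset.range n ×ˢ Finset.range (lam 0), ((t p.1 p.2).card - 1)

/-- Column `c` contains the entry `a`. -/
def colHas (n : ℕ) (t : Filling) (a c : ℕ) : Prop := ∃ r, r < n ∧ a ∈ t r c

/-- The sign of column `c` for the `i`-signature rule: `+` (true) if the column contains `i`
but not `i+1`, `-` (false) if it contains `i+1` but not `i`. -/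
def colSign (n : ℕ) (t : Filling) (i c : ℕ) : Option Bool :=
  if colHas n t i c ∧ ¬ colHas n t (i + 1) c then some true
  else if colHas n t (i + 1) c ∧ ¬ colHas n t i c then some false
  else none

/-- The number of `-` (false) signs left uncanceled after scanning the word left-to-right,
iteratively canceling `-+` pairs. -/
def mctr (w : List Bool) : ℕ := w.foldl (fun cnt b => if b then cnt - 1 else cnt + 1) 0

/-- The number of `+` (true) signs left uncanceled, scanning right-to-left. -/
def pctr (w : List Bool) : ℕ := w.foldr (fun b cnt => if b then cnt + 1 else cnt - 1) 0

/-- The word of column signs of the columns before column `c`. -/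
def colWordBefore (n : ℕ) (t : Filling) (i c : ℕ) : List Bool :=
  (List.range c).filterMap (colSign n t i)

/-- The word of column signs of the columns after column `c` (among columns `< ncols`). -/
def colWordAfter (n ncols : ℕ) (t : Filling) (i c : ℕ) : List Bool :=
  ((List.range ncols).drop (c + 1)).filterMap (colSign n t i)

/-- Column `c` carries an uncanceled `+` for the `i`-signature rule. -/
def PlusCol (n ncols : ℕ) (t : Filling) (i c : ℕ) : Prop :=
  c < ncols ∧ colSign n t i c = some true ∧ mctr (colWordBefore n t i c) = 0

/-- Column `c` carries an uncanceled `-` for the `i`-signature rule. -/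
def MinusCol (n ncols : ℕ) (t : Filling) (i c : ℕ) : Prop :=
  c < ncols ∧ colSign n t i c = some false ∧ pctr (colWordAfter n ncols t i c) = 0

/-- Column `c` is the rightmost uncanceled `+`. -/
def fBoxCol (n ncols : ℕ) (t : Filling) (i c : ℕ) : Prop :=
  PlusCol n ncols t i c ∧ ∀ c', PlusCol n ncols t i c' → c' ≤ c

/-- Column `c` is the leftmost uncanceled `-`. -/
def eBoxCol (n ncols : ℕ) (t : Filling) (i c : ℕ) : Prop :=
  MinusCol n ncols t i c ∧ ∀ c', MinusCol n ncols t i c' → c ≤ c'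

/-- Replace the content of the box in row `r`, column `c` by `A`. -/
def updateBox (t : Filling) (r c : ℕ) (A : Finset ℕ) : Filling :=
  fun r' c' => if r' = r ∧ c' = c then A else t r' c'

/-- The set-valued crystal operator `f_i` (signature rule). -/
def fRaw (n : ℕ) (lam : ℕ → ℕ) (i : ℕ) (t : Filling) : Option Filling :=
  if h : ∃ c, fBoxCol n (lam 0) t i c then
    let c := Classical.choose h
    if hr : ∃ r, r < n ∧ i ∈ t r c then
      let r := Classical.choose hr
      if i ∈ t r (c + 1) then
        some (updateBox (updateBox t r (c + 1) ((t r (c + 1)).erase i)) r c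
          (insert (i + 1) (t r c)))
      else some (updateBox t r c (insert (i + 1) ((t r c).erase i)))
    else none
  else none

/-- The set-valued crystal operator `e_i` (signature rule). -/
def eRaw (n : ℕ) (lam : ℕ → ℕ) (i : ℕ) (t : Filling) : Option Filling :=
  if h : ∃ c, eBoxCol n (lam 0) t i c then
    let c := Classical.choose h
    if hr : ∃ r, r < n ∧ (i + 1) ∈ t r c then
      let r := Classical.choose hr
      if 0 < c ∧ (i + 1) ∈ t r (c - 1) then
        some (updateBox (updateBox t r (c - 1) ((t r (c - 1)).erase (i + 1))) r c
          (insert i (t r c)))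
      else some (updateBox t r c (insert i ((t r c).erase (i + 1))))
    else none
  else none

/-- Iterate a partially-defined operator. -/
def iterOpt (g : Filling → Option Filling) : ℕ → Filling → Option Filling
  | 0, t => some t
  | m + 1, t => (iterOpt g m t).bind g

/-- Highest weight (Yamanouchi) elements. -/
def IsYamanouchi (n : ℕ) (lam : ℕ → ℕ) (t : Filling) : Prop :=
  ∀ i, 1 ≤ i → i < n → eRaw n lam i t = none

/-- Closure of `t0` under the crystal operators `e_i`, `f_i` for `1 ≤ i < n`. -/
inductive Reach (n : ℕ) (lam : ℕ → ℕ) (t0 : Filling) : Filling → Prop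
  | base : Reach n lam t0 t0
  | stepF : ∀ {t t' : Filling} (i : ℕ), 1 ≤ i → i < n → Reach n lam t0 t →
      fRaw n lam i t = some t' → Reach n lam t0 t'
  | stepE : ∀ {t t' : Filling} (i : ℕ), 1 ≤ i → i < n → Reach n lam t0 t →
      eRaw n lam i t = some t' → Reach n lam t0 t'

/-- The one-row partition `(s)`. -/
def rowShape (s : ℕ) : ℕ → ℕ := fun r => if r = 0 then s else 0

/-- The one-column partition `(1^k)`. -/
def colShape (k : ℕ) : ℕ → ℕ := fun r => if r < k then 1 else 0

/-- The hook partition `(s, 1^e)`. -/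
def hookShape (s e : ℕ) : ℕ → ℕ := fun r => if r = 0 then s else if r ≤ e then 1 else 0

/-! ### K-theory crystal operators (for single rows and single columns) -/

/-- Some box of the tableau contains the entry `a`. -/
def containsEntry (n : ℕ) (lam : ℕ → ℕ) (t : Filling) (a : ℕ) : Prop :=
  ∃ r c, r < n ∧ c < lam r ∧ a ∈ t r c

/-- `p` is the rightmost box of `t` containing `i`. -/
def KBoxF (n : ℕ) (lam : ℕ → ℕ) (t : Filling) (i : ℕ) (p : ℕ × ℕ) : Prop :=
  p.1 < n ∧ p.2 < lam p.1 ∧ i ∈ t p.1 p.2 ∧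
    ∀ q : ℕ × ℕ, q.1 < n → q.2 < lam q.1 → i ∈ t q.1 q.2 → q.2 ≤ p.2

/-- The K-crystal operator `f_i^K`: if `i` occurs in `t` and `i+1` does not, add `i+1` to
the rightmost box containing `i`; otherwise `0`. -/
def fK (n : ℕ) (lam : ℕ → ℕ) (i : ℕ) (t : Filling) : Option Filling :=
  if h : (∃ p : ℕ × ℕ, KBoxF n lam t i p) ∧ ¬ containsEntry n lam t (i + 1) then
    let p := Classical.choose h.1
    some (updateBox t p.1 p.2 (insert (i + 1) (t p.1 p.2)))
  else none

/-- The K-crystal operator `e_i^K`: delete `i+1` from the box containing both `i` and `i+1`,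
if such a box exists; otherwise `0`. -/
def eK (n : ℕ) (lam : ℕ → ℕ) (i : ℕ) (t : Filling) : Option Filling :=
  if h : ∃ p : ℕ × ℕ, p.1 < n ∧ p.2 < lam p.1 ∧ i ∈ t p.1 p.2 ∧ (i + 1) ∈ t p.1 p.2 then
    let p := Classical.choose h
    some (updateBox t p.1 p.2 ((t p.1 p.2).erase (i + 1)))
  else none

/-- `t'` is the result of applying `g` to `t` as many times as possible. -/
def MaxApply (g : Filling → Option Filling) (t t' : Filling) : Prop :=
  (∃ m, iterOpt g m t = some t') ∧ g t' = none

/-- One Demazure step: apply `e_i` as many times as possible, then `e_i^K` as many times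
as possible (here `eKop i` is the `i`-th K-operator). -/
def DemStep (n : ℕ) (lam : ℕ → ℕ) (eKop : ℕ → Filling → Option Filling) (i : ℕ)
    (t t' : Filling) : Prop :=
  ∃ t1, MaxApply (eRaw n lam i) t t1 ∧ MaxApply (eKop i) t1 t'

/-- `DemReach n lam eKop [i₁,…,iℓ] t u` holds when
`u = (e_{iℓ}^K)^max e_{iℓ}^max ⋯ (e_{i₁}^K)^max e_{i₁}^max t`. -/
def DemReach (n : ℕ) (lam : ℕ → ℕ) (eKop : ℕ → Filling → Option Filling) :
    List ℕ → Filling → Filling → Prop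
  | [], t, u => t = u
  | i :: rest, t, u => ∃ t2, DemStep n lam eKop i t t2 ∧ DemReach n lam eKop rest t2 u

/-- The minimal highest weight tableau `u_λ`, whose row `r` boxes are all `{r+1}`. -/
def uTab (lam : ℕ → ℕ) : Filling := fun r c => if c < lam r then {r + 1} else ∅

/-- The K-Demazure crystal associated with a word `[i₁,…,iℓ]`. -/
def KDem (n : ℕ) (lam : ℕ → ℕ) (eKop : ℕ → Filling → Option Filling) (word : List ℕ) :
    Set Filling :=
  {t | IsSVT n lam t ∧ DemReach n lam eKop word t (uTab lam)}

/-! ### Permutations and reduced words -/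

/-- The permutation `s_{i₁} ⋯ s_{iℓ}` of a word `[i₁,…,iℓ]`, where `s_i` swaps `i`, `i+1`. -/
def wordPerm (word : List ℕ) : Equiv.Perm ℕ :=
  (word.map fun i => Equiv.swap i (i + 1)).prod

/-- `word` is a reduced word for `w` in the Coxeter generators `s_1, …, s_{n-1}`. -/
def IsReducedWord (n : ℕ) (w : Equiv.Perm ℕ) (word : List ℕ) : Prop :=
  (∀ i ∈ word, 1 ≤ i ∧ i < n) ∧ wordPerm word = w ∧
    ∀ word' : List ℕ, (∀ i ∈ word', 1 ≤ i ∧ i < n) → wordPerm word' = w →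
      word.length ≤ word'.length

/-- The Coxeter length of a permutation of `{1,…,n}`. -/
def permLength (n : ℕ) (σ : Equiv.Perm ℕ) : ℕ :=
  sInf {l | ∃ word : List ℕ, (∀ i ∈ word, 1 ≤ i ∧ i < n) ∧ wordPerm word = σ ∧
    word.length = l}

/-- The parabolic subgroup generated by `s_2, …, s_{n-1}`. -/
def parabolic (n : ℕ) : Subgroup (Equiv.Perm ℕ) :=
  Subgroup.closure {σ | ∃ i, 2 ≤ i ∧ i < n ∧ σ = Equiv.swap i (i + 1)}

/-! ### Polynomials -/

/-- Polynomials in `x₁, x₂, …` over `ℤ[β]`; the variable `β` is `Polynomial.X`. -/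
abbrev KPoly : Type := MvPolynomial ℕ (Polynomial ℤ)

/-- The scalar `β`. -/
def betaP : KPoly := MvPolynomial.C Polynomial.X

/-- The monomial `x^{wt(T)} = x₁^{wt₁} ⋯ xₙ^{wtₙ}`. -/
def xwt (n : ℕ) (lam : ℕ → ℕ) (t : Filling) : KPoly :=
  ∏ j ∈ Finset.Icc 1 n, (MvPolynomial.X j : KPoly) ^ wt n lam t j

/-- The β-character `∑_{T ∈ S} β^{excess T} x^{wt T}` of a set of tableaux. -/
def charSet (n : ℕ) (lam : ℕ → ℕ) (S : Set Filling) : KPoly :=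
  ∑ᶠ t ∈ S, betaP ^ excess n lam t * xwt n lam t

/-- The symmetric Grothendieck polynomial `𝔊_λ(x₁,…,xₙ; β)`. -/
def Groth (n : ℕ) (lam : ℕ → ℕ) : KPoly :=
  charSet n lam {t | IsSVT n lam t}

/-- The Schur polynomial `s_μ(x₁,…,xₙ)`. -/
def SchurP (n : ℕ) (mu : ℕ → ℕ) : KPoly :=
  ∑ᶠ t ∈ {t : Filling | IsSSYT n mu t}, xwt n mu t

/-- The numerator defining the Demazure–Lascoux operator `ϖ_i`. -/
def DLnum (i : ℕ) (f : KPoly) : KPoly :=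
  (MvPolynomial.X i + betaP * MvPolynomial.X i * MvPolynomial.X (i + 1)) * f -
    (MvPolynomial.X (i + 1) + betaP * MvPolynomial.X i * MvPolynomial.X (i + 1)) *
      (MvPolynomial.rename (Equiv.swap i (i + 1)) f)

/-- `DL` implements the Demazure–Lascoux operators `ϖ_i` for `1 ≤ i < n`:
`(x_i - x_{i+1}) · ϖ_i f` equals the defining numerator. -/
def IsDLOp (n : ℕ) (DL : ℕ → KPoly → KPoly) : Prop :=
  ∀ i, 1 ≤ i → i < n → ∀ f : KPoly,
    (MvPolynomial.X i - MvPolynomial.X (i + 1)) * DL i f = DLnum i f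

/-- `applyDL DL [i₁,…,iℓ] f = ϖ_{i₁} ϖ_{i₂} ⋯ ϖ_{iℓ} f`. -/
def applyDL (DL : ℕ → KPoly → KPoly) : List ℕ → KPoly → KPoly
  | [], f => f
  | i :: rest, f => DL i (applyDL DL rest f)

/-- The one-row tableau `U_μ` whose first `s-1` boxes are `{1}` and whose last box is
`{1, 2, …, k}`. -/
def Umu (s k : ℕ) : Filling := fun r c =>
  if r = 0 ∧ c + 1 < s then {1}
  else if r = 0 ∧ c + 1 = s then Finset.Icc 1 k
  else ∅

/-! ### Generalities on the signature rule -/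

theorem fRaw_eq_some {n i c r : ℕ} {lam : ℕ → ℕ} {t : Filling}
    (hc : fBoxCol n (lam 0) t i c) (hr : r < n) (hm : i ∈ t r c)
    (hu : ∀ r', i ∈ t r' c → r' = r) :
    fRaw n lam i t = some (if i ∈ t r (c + 1) then
      updateBox (updateBox t r (c + 1) ((t r (c + 1)).erase i)) r c (insert (i + 1) (t r c))
      else updateBox t r c (insert (i + 1) ((t r c).erase i))) := by
  have h : ∃ c, fBoxCol n (lam 0) t i c := ⟨c, hc⟩
  have hcc : Classical.choose h = c :=
    le_antisymm (hc.2 _ (Classical.choose_spec h).1) ((Classical.choose_spec h).2 _ hc.1)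
  have h2 : ∃ r, r < n ∧ i ∈ t r c := ⟨r, hr, hm⟩
  have hrr : Classical.choose h2 = r := hu _ (Classical.choose_spec h2).2
  unfold fRaw
  simp only [dif_pos h, hcc, dif_pos h2, hrr]
  split_ifs <;> rfl

theorem eRaw_eq_some {n i c r : ℕ} {lam : ℕ → ℕ} {t : Filling}
    (hc : eBoxCol n (lam 0) t i c) (hr : r < n) (hm : i + 1 ∈ t r c)
    (hu : ∀ r', i + 1 ∈ t r' c → r' = r) :
    eRaw n lam i t = some (if 0 < c ∧ i + 1 ∈ t r (c - 1) then
      updateBox (updateBox t r (c - 1) ((t r (c - 1)).erase (i + 1))) r c (insert i (t r c))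
      else updateBox t r c (insert i ((t r c).erase (i + 1)))) := by
  have h : ∃ c, eBoxCol n (lam 0) t i c := ⟨c, hc⟩
  have hcc : Classical.choose h = c :=
    le_antisymm ((Classical.choose_spec h).2 _ hc.1) (hc.2 _ (Classical.choose_spec h).1)
  have h2 : ∃ r, r < n ∧ i + 1 ∈ t r c := ⟨r, hr, hm⟩
  have hrr : Classical.choose h2 = r := hu _ (Classical.choose_spec h2).2
  unfold eRaw
  simp only [dif_pos h, hcc, dif_pos h2, hrr]
  split_ifs <;> rfl

theorem fRaw_eq_none {n i : ℕ} {lam : ℕ → ℕ} {t : Filling}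
    (h : ∀ c, ¬ PlusCol n (lam 0) t i c) : fRaw n lam i t = none :=
  dif_neg fun ⟨c, hc⟩ => h c hc.1

theorem eRaw_eq_none {n i : ℕ} {lam : ℕ → ℕ} {t : Filling}
    (h : ∀ c, ¬ MinusCol n (lam 0) t i c) : eRaw n lam i t = none :=
  dif_neg fun ⟨c, hc⟩ => h c hc.1

theorem colSign_eq_true {n i c : ℕ} {t : Filling} :
    colSign n t i c = some true ↔ colHas n t i c ∧ ¬ colHas n t (i + 1) c := by
  unfold colSign; split_ifs <;> simp_all

theorem colSign_eq_false {n i c : ℕ} {t : Filling} :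
    colSign n t i c = some false ↔ colHas n t (i + 1) c ∧ ¬ colHas n t i c := by
  unfold colSign; split_ifs <;> simp_all

theorem foldl_mctr_of_all_true (w : List Bool) (h : ∀ x ∈ w, x = true) (m : ℕ) :
    w.foldl (fun cnt b => if b then cnt - 1 else cnt + 1) m = m - w.length := by
  induction w generalizing m with
  | nil => simp
  | cons x w ih =>
    have hx : x = true := h x (by simp)
    subst hx
    simp only [List.foldl_cons, if_true, List.length_cons]
    rw [ih fun y hy => h y (by simp [hy])]
    rw [Nat.sub_sub, Nat.add_comm]

theorem mctr_of_all_true (w : List Bool) (h : ∀ x ∈ w, x = true) : mctr w = 0 := by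
  unfold mctr; rw [foldl_mctr_of_all_true w h]; simp

theorem mctr_false_cons (w : List Bool) (h : ∀ x ∈ w, x = true) :
    mctr (false :: w) = 1 - w.length := by
  unfold mctr; rw [List.foldl_cons, foldl_mctr_of_all_true w h]; simp

theorem pctr_of_all_false (w : List Bool) (h : ∀ x ∈ w, x = false) : pctr w = 0 := by
  induction w with
  | nil => rfl
  | cons x w ih =>
    have hx : x = false := h x (by simp)
    have := ih fun y hy => h y (by simp [hy])
    subst hx
    simp only [pctr, List.foldr_cons] at this ⊢
    simp [this]

theorem pctr_ne_zero {w : List Bool} (h : w.Pairwise fun x y => y = true → x = true)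
    (ht : true ∈ w) : pctr w ≠ 0 := by
  cases w with
  | nil => simp at ht
  | cons x w =>
    have hx : x = true := by
      rcases List.mem_cons.1 ht with h' | h'
      · exact h'.symm
      · exact (List.pairwise_cons.1 h).1 _ h' rfl
    subst hx
    simp [pctr]

theorem mem_colWordBefore {n i c : ℕ} {t : Filling} {x : Bool} :
    x ∈ colWordBefore n t i c ↔ ∃ d < c, colSign n t i d = some x := by
  simp [colWordBefore]

theorem drop_range (m c : ℕ) : (List.range m).drop c = List.range' c (m - c) := by
  rw [List.range_eq_range', List.drop_range']; simp

theorem mem_colWordAfter {n m i c : ℕ} {t : Filling} {x : Bool} :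
    x ∈ colWordAfter n m t i c ↔ ∃ d, c < d ∧ d < m ∧ colSign n t i d = some x := by
  simp only [colWordAfter, drop_range, List.mem_filterMap, List.mem_range'_1]
  constructor
  · rintro ⟨d, hd, h⟩; exact ⟨d, by omega, by omega, h⟩
  · rintro ⟨d, h1, h2, h⟩; exact ⟨d, by omega, h⟩

/-! ### Pairs encoding one-row set-valued tableaux and hook tableaux -/

/-- `b` lists the first row of a hook tableau and `J` is the set of entries of its leg. For a
one-row set-valued tableau, `b` lists the minima of the boxes and `J` is the set of the other
entries. -/
structure IsHookData (n s k : ℕ) (b : ℕ → ℕ) (J : Finset ℕ) : Prop where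
  mono : ∀ c d, c ≤ d → d < s → b c ≤ b d
  bounds : ∀ c, c < s → 1 ≤ b c ∧ b c ≤ n
  zero : ∀ c, s ≤ c → b c = 0
  leg : ∀ v ∈ J, b 0 < v ∧ v ≤ n
  card : J.card + 1 = k

/-- The one-row set-valued tableau with minima `b` and other entries `J`. -/
def rowF (s : ℕ) (b : ℕ → ℕ) (J : Finset ℕ) : Filling := fun r c =>
  if r = 0 ∧ c < s then
    insert (b c) (J.filter fun v => b c < v ∧ (c + 1 < s → v ≤ b (c + 1)))
  else ∅

/-- The number of elements of `J` below `v`. -/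
def rank (J : Finset ℕ) (v : ℕ) : ℕ := (J.filter (· < v)).card

/-- The hook tableau with first row `b` and leg `J`. -/
def hookF (s : ℕ) (b : ℕ → ℕ) (J : Finset ℕ) : Filling := fun r c =>
  if r = 0 then (if c < s then {b c} else ∅)
  else if c = 0 then J.filter fun v => rank J v + 1 = r else ∅

/-- The crystal operator `f_i` on pairs, as a relation. -/
def Step (s i : ℕ) (b : ℕ → ℕ) (J : Finset ℕ) (b' : ℕ → ℕ) (J' : Finset ℕ) : Prop :=
  (∃ p, p < s ∧ b p = i ∧ (p + 1 < s → i < b (p + 1)) ∧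
    (i + 1 ∈ J → i ∈ J ∨ (0 < p ∧ b (p - 1) = i)) ∧
    b' = Function.update b p (i + 1) ∧ J' = J) ∨
  ((∀ c, c < s → b c ≠ i) ∧ i ∈ J ∧ i + 1 ∉ J ∧ b' = b ∧ J' = insert (i + 1) (J.erase i))

section

variable {n s k i : ℕ} {b b' : ℕ → ℕ} {J J' : Finset ℕ}

theorem Step.isHookData (hin : i < n) (h : IsHookData n s k b J)
    (hst : Step s i b J b' J') : IsHookData n s k b' J' := by
  obtain ⟨h1, h2, h3, h4, h5⟩ := h
  rcases hst with ⟨p, hp, hbp, hlt, hJ, rfl, rfl⟩ | ⟨hb, hi, hi', rfl, rfl⟩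
  · refine ⟨fun c d hcd hd => ?_, fun c hc => ?_, fun c hc => ?_, fun v hv => ⟨?_, (h4 v hv).2⟩, h5⟩
    · simp only [Function.update_apply]
      have := h1 c d hcd hd
      split_ifs with hc' hd'
      · exact le_rfl
      · have := h1 (p + 1) d (by omega) hd
        have := hlt (by omega)
        omega
      · subst_vars; omega
      · exact this
    · simp only [Function.update_apply]
      have := h2 c hc
      split_ifs <;> omega
    · rw [Function.update_apply, if_neg (by omega), h3 c hc]
    · have := (h4 v hv).1
      simp only [Function.update_apply]
      split_ifs with hp0
      · subst hp0
        have : v ≠ i + 1 := by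
          rintro rfl
          rcases hJ hv with hh | hh
          · have := (h4 i hh).1; omega
          · omega
        omega
      · exact this
  · refine ⟨h1, h2, h3, fun v hv => ?_, ?_⟩
    · have := h4 i hi
      rcases Finset.mem_insert.1 hv with rfl | hv
      · omega
      · exact h4 v (Finset.mem_of_mem_erase hv)
    · rw [Finset.card_insert_of_notMem (by simp [hi']), Finset.card_erase_of_mem hi]
      have := Finset.card_pos.2 ⟨i, hi⟩
      omega

/-- Every pair which is not of highest weight in direction `i` is an image under `f_i`. -/
theorem exists_step (hi1 : 1 ≤ i) (h : IsHookData n s k b J)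
    (hc : (i + 1 ∈ J ∧ (∀ c, c < s → b c ≠ i) ∧ i ∉ J) ∨ ∃ c, c < s ∧ b c = i + 1) :
    ∃ b' J', IsHookData n s k b' J' ∧ Step s i b' J' b J ∧
      ∑ c ∈ Finset.range s, b' c + ∑ v ∈ J', v < ∑ c ∈ Finset.range s, b c + ∑ v ∈ J, v := by
  obtain ⟨h1, h2, h3, h4, h5⟩ := h
  by_cases hC : i + 1 ∈ J ∧ (∀ c, c < s → b c ≠ i) ∧ i ∉ J
  · obtain ⟨hJ, hb, hiJ⟩ := hC
    have hcard := Finset.card_pos.2 ⟨i + 1, hJ⟩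
    refine ⟨b, insert i (J.erase (i + 1)), ⟨h1, h2, h3, fun v hv => ?_, ?_⟩,
      Or.inr ⟨hb, by simp, by simp, rfl, ?_⟩, ?_⟩
    · have hJ4 := h4 _ hJ
      rcases Finset.mem_insert.1 hv with rfl | hv
      · refine ⟨?_, by omega⟩
        rcases Nat.eq_zero_or_pos s with rfl | hs
        · rw [h3 0 le_rfl]; omega
        · have := hb 0 hs
          omega
      · exact h4 v (Finset.mem_of_mem_erase hv)
    · rw [Finset.card_insert_of_notMem (by simp [hiJ]), Finset.card_erase_of_mem hJ]
      omega
    · ext v; simp only [Finset.mem_insert, Finset.mem_erase]; grind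
    · rw [Finset.sum_insert (by simp [hiJ])]
      have := Finset.add_sum_erase J (fun v => v) hJ
      omega
  · have hex : ∃ c, c < s ∧ b c = i + 1 := hc.resolve_left hC
    obtain ⟨hp, hbp⟩ := Nat.find_spec hex
    have hmin : ∀ c, c < Nat.find hex → b c ≤ i := fun c hlt => by
      have := Nat.find_min hex hlt
      have := h1 c _ hlt.le hp
      have : b c ≠ i + 1 := fun hh => Nat.find_min hex hlt ⟨by omega, hh⟩
      omega
    generalize Nat.find hex = p at hp hbp hmin
    have hJ : i + 1 ∈ J → i ∈ J ∨ (0 < p ∧ b (p - 1) = i) := fun hJ => by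
      by_contra hcon
      push Not at hcon
      refine hC ⟨hJ, fun c hcs hci => ?_, hcon.1⟩
      have hcp : c < p := by
        by_contra hge
        have := h1 p c (by omega) hcs
        omega
      have := h1 c (p - 1) (by omega) (by omega)
      have := hmin (p - 1) (by omega)
      exact hcon.2 (by omega) (by omega)
    refine ⟨Function.update b p i, J, ⟨fun c d hcd hd => ?_, fun c hc => ?_, fun c hc => ?_,
      fun v hv => ⟨?_, (h4 v hv).2⟩, h5⟩,
      Or.inl ⟨p, hp, by simp, fun hps => ?_, fun hi => ?_, ?_, rfl⟩, ?_⟩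
    · simp only [Function.update_apply]
      have := h1 c d hcd hd
      split_ifs with hc' hd' hd'
      · exact le_rfl
      · subst_vars; omega
      · exact hmin c (by omega)
      · exact this
    · simp only [Function.update_apply]
      have := h2 c hc
      have := h2 p hp
      split_ifs <;> omega
    · rw [Function.update_apply, if_neg (by omega), h3 c hc]
    · have := (h4 v hv).1
      simp only [Function.update_apply]
      split_ifs with hp0
      · subst hp0; omega
      · exact this
    · have := h1 p (p + 1) (by omega) hps
      rw [Function.update_of_ne (by omega)]; omega
    · rcases hJ hi with hh | ⟨hh, hh'⟩
      · exact Or.inl hh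
      · exact Or.inr ⟨hh, by rw [Function.update_of_ne (by omega)]; exact hh'⟩
    · simp [← hbp]
    · refine Nat.add_lt_add_right (Finset.sum_lt_sum (fun c _ => ?_) ⟨p, by simpa, ?_⟩) _
      · simp only [Function.update_apply]; split_ifs
        · subst_vars; omega
        · exact le_rfl
      · simp [hbp]

/-! ### One-row set-valued tableaux -/

theorem mem_rowF {c v : ℕ} : v ∈ rowF s b J 0 c ↔
    c < s ∧ (v = b c ∨ (v ∈ J ∧ b c < v ∧ (c + 1 < s → v ≤ b (c + 1)))) := by
  unfold rowF; split_ifs <;> simp_all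

theorem rowF_of_ne_zero {r c : ℕ} (hr : r ≠ 0) : rowF s b J r c = ∅ := by simp [rowF, hr]

theorem colHas_rowF {c a : ℕ} (hn : 0 < n) :
    colHas n (rowF s b J) a c ↔ a ∈ rowF s b J 0 c := by
  constructor
  · rintro ⟨r, -, hr⟩
    by_cases h : r = 0
    · rwa [h] at hr
    · simp [rowF_of_ne_zero h] at hr
  · exact fun h => ⟨0, hn, h⟩

/-- Entries in distinct boxes of the row are weakly increasing. -/
theorem rowF_le (h : IsHookData n s k b J) {c d v w : ℕ} (hcd : c < d)
    (hv : v ∈ rowF s b J 0 c) (hw : w ∈ rowF s b J 0 d) : v ≤ w := by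
  rw [mem_rowF] at hv hw
  have h1 := h.mono (c + 1) d hcd hw.1
  have h2 := h.mono c d hcd.le hw.1
  have : c + 1 < s := by omega
  grind

theorem plusCol_rowF (hn : 0 < n) (h : IsHookData n s k b J) {c : ℕ} :
    PlusCol n (rowShape s 0) (rowF s b J) i c ↔
      i ∈ rowF s b J 0 c ∧ i + 1 ∉ rowF s b J 0 c := by
  simp only [PlusCol, colSign_eq_true, colHas_rowF hn]
  refine ⟨fun h => h.2.1, fun hc => ⟨by simpa [rowShape] using (mem_rowF.1 hc.1).1, hc, ?_⟩⟩
  refine mctr_of_all_true _ fun x hx => ?_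
  obtain ⟨d, hd, hx⟩ := mem_colWordBefore.1 hx
  cases x with
  | true => rfl
  | false =>
    rw [colSign_eq_false, colHas_rowF hn] at hx
    have := rowF_le h hd hx.1 hc.1
    omega

theorem minusCol_rowF (hn : 0 < n) (h : IsHookData n s k b J) {c : ℕ} :
    MinusCol n (rowShape s 0) (rowF s b J) i c ↔
      i + 1 ∈ rowF s b J 0 c ∧ i ∉ rowF s b J 0 c := by
  simp only [MinusCol, colSign_eq_false, colHas_rowF hn]
  refine ⟨fun h => h.2.1, fun hc => ⟨by simpa [rowShape] using (mem_rowF.1 hc.1).1, hc, ?_⟩⟩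
  refine pctr_of_all_false _ fun x hx => ?_
  obtain ⟨d, hd, -, hx⟩ := mem_colWordAfter.1 hx
  cases x with
  | false => rfl
  | true =>
    rw [colSign_eq_true, colHas_rowF hn] at hx
    have := rowF_le h hd hc.1 hx.1
    omega

theorem lt_of_mem_rowF {p c v : ℕ} (h : IsHookData n s k b J) (hp : p + 1 < s → i < b (p + 1))
    (hv : v ∈ rowF s b J 0 c) (hc : p < c) : i < v := by
  have h1 := (mem_rowF.1 hv).1
  have := h.mono (p + 1) c hc h1
  have := hp (by omega)
  have := (mem_rowF.1 hv).2
  omega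

theorem exists_box {v : ℕ} (h : IsHookData n s k b J) (hs : 0 < s) (hv : v ∈ J) :
    ∃ c, c < s ∧ b c < v ∧ ∀ d, c < d → d < s → v ≤ b d := by
  have hex : ∃ c, c < s ∧ b c < v := ⟨0, hs, (h.leg v hv).1⟩
  refine ⟨Nat.findGreatest (fun c => c < s ∧ b c < v) s, ?_⟩
  have h1 := Nat.findGreatest_spec (P := fun c => c < s ∧ b c < v) hs.le ⟨hs, (h.leg v hv).1⟩
  refine ⟨h1.1, h1.2, fun d hd hds => ?_⟩
  have := Nat.findGreatest_is_greatest hd hds.le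
  simp only [hds, true_and, not_lt] at this
  exact this

theorem exists_max {i : ℕ} (h : IsHookData n s k b J) (hex : ∃ c, c < s ∧ b c = i) :
    ∃ p, p < s ∧ b p = i ∧ (p + 1 < s → i < b (p + 1)) := by
  obtain ⟨c, hc, hb⟩ := hex
  have h1 := Nat.findGreatest_spec (P := fun c => c < s ∧ b c = i) hc.le ⟨hc, hb⟩
  refine ⟨_, h1.1, h1.2, fun hlt => ?_⟩
  have h2 := Nat.findGreatest_is_greatest (P := fun c => c < s ∧ b c = i)
    (Nat.lt_succ_self _) hlt.le
  have h3 := h.mono _ _ (Nat.le_succ _) hlt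
  grind

theorem fRaw_rowF_none (hn : 0 < n) (h : IsHookData n s k b J)
    (hno : ¬ ∃ b' J', Step s i b J b' J') : fRaw n (rowShape s) i (rowF s b J) = none := by
  refine fRaw_eq_none fun c hc => hno ?_
  obtain ⟨hc, hc'⟩ := (plusCol_rowF hn h).1 hc
  by_cases hex : ∃ c, c < s ∧ b c = i
  · obtain ⟨p, hp, hbp, hlt⟩ := exists_max h hex
    refine ⟨_, _, Or.inl ⟨p, hp, hbp, hlt, fun hJ => ?_, rfl, rfl⟩⟩
    by_contra hcon
    push Not at hcon
    rw [mem_rowF] at hc hc'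
    obtain ⟨hcs, hc⟩ := hc
    have hbc : b c = i := by grind
    have h1 : c ≤ p := by
      by_contra hlt'
      have := h.mono (p + 1) c (by omega) hcs
      have := hlt (by omega)
      omega
    rcases h1.eq_or_lt with rfl | h1
    · exact hc' ⟨hcs, Or.inr ⟨hJ, by omega, fun hh => hlt hh⟩⟩
    · have := h.mono c (p - 1) (by omega) (by omega)
      have := h.mono (p - 1) p (by omega) (by omega)
      exact hcon.2 (by omega) (by omega)
  · push Not at hex
    rw [mem_rowF] at hc hc'
    have := hex c hc.1
    refine ⟨_, _, Or.inr ⟨hex, by grind,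
      fun hJ => hc' ⟨hc.1, Or.inr ⟨hJ, by grind, fun hh => ?_⟩⟩, rfl, rfl⟩⟩
    have := hex _ hh
    grind

theorem fRaw_rowF_some (hn : 0 < n) (hs : 0 < s) (h : IsHookData n s k b J)
    (hst : Step s i b J b' J') :
    fRaw n (rowShape s) i (rowF s b J) = some (rowF s b' J') := by
  have hu : ∀ c r', i ∈ rowF s b J r' c → r' = 0 := fun c r' hr => by
    by_contra hne
    simp [rowF_of_ne_zero hne] at hr
  rcases hst with ⟨p, hp, hbp, hlt, hJ, rfl, rfl⟩ | ⟨hb, hi, hi', rfl, rfl⟩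
  · by_cases hiJ : i + 1 ∈ J'
    · have hp0 : 0 < p := by
        rcases hJ hiJ with hh | hh
        · by_contra h0
          have := (h.leg _ hh).1
          have h0 : p = 0 := by omega
          subst h0; omega
        · exact hh.1
      obtain ⟨p, rfl⟩ : ∃ q, p = q + 1 := ⟨p - 1, by omega⟩
      have hle := h.mono p (p + 1) (by omega) hp
      simp only [Nat.add_sub_cancel] at hJ
      have hmem : i ∈ rowF s b J' 0 p := mem_rowF.2 (by grind)
      have hmem' : i ∈ rowF s b J' 0 (p + 1) := mem_rowF.2 (by grind)
      have hbox : fBoxCol n (rowShape s 0) (rowF s b J') i p := by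
        refine ⟨(plusCol_rowF hn h).2 ⟨hmem, fun hh => ?_⟩, fun c hc => ?_⟩
        · have := rowF_le h (Nat.lt_succ_self p) hh hmem'
          omega
        · obtain ⟨hc, hc'⟩ := (plusCol_rowF hn h).1 hc
          by_contra hpc
          rcases Nat.lt_or_ge (p + 1) c with h1 | h1
          · have := lt_of_mem_rowF h hlt hc h1
            omega
          · obtain rfl : c = p + 1 := by omega
            exact hc' (mem_rowF.2 (by grind))
      rw [fRaw_eq_some hbox hn hmem (hu p), if_pos hmem']
      congr 1
      funext r c
      by_cases hr : r = 0
      · subst hr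
        ext v
        simp only [updateBox, true_and]
        rcases lt_trichotomy c p with hcp | rfl | hcp
        · rw [if_neg (by omega), if_neg (by omega), mem_rowF, mem_rowF]
          simp [show c ≠ p + 1 by omega, show c ≠ p by omega]
        · rw [if_pos rfl, Finset.mem_insert, mem_rowF, mem_rowF]
          simp only [Function.update_apply]
          grind
        · rw [if_neg (by omega)]
          split_ifs with h1
          · subst h1
            rw [Finset.mem_erase, mem_rowF, mem_rowF]
            simp only [Function.update_apply]
            grind
          · rw [mem_rowF, mem_rowF]
            simp [h1, show c ≠ p by omega]
      · simp [updateBox, hr, rowF_of_ne_zero]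
    · have hmem : i ∈ rowF s b J' 0 p := mem_rowF.2 (by grind)
      have hmem' : i ∉ rowF s b J' 0 (p + 1) := fun hh => by
        have := lt_of_mem_rowF h hlt hh (Nat.lt_succ_self p)
        omega
      have hbox : fBoxCol n (rowShape s 0) (rowF s b J') i p := by
        refine ⟨(plusCol_rowF hn h).2 ⟨hmem, fun hh => ?_⟩, fun c hc => ?_⟩
        · have := (mem_rowF.1 hh).2
          grind
        · obtain ⟨hc, hc'⟩ := (plusCol_rowF hn h).1 hc
          by_contra hpc
          have := lt_of_mem_rowF h hlt hc (by omega)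
          omega
      rw [fRaw_eq_some hbox hn hmem (hu p), if_neg hmem']
      congr 1
      funext r c
      by_cases hr : r = 0
      · subst hr
        ext v
        simp only [updateBox, true_and]
        split_ifs with h1
        · subst h1
          rw [Finset.mem_insert, Finset.mem_erase, mem_rowF, mem_rowF]
          simp only [Function.update_apply]
          grind
        · rw [mem_rowF, mem_rowF]
          simp only [Function.update_apply]
          grind
      · simp [updateBox, hr, rowF_of_ne_zero]
  · obtain ⟨p, hp, hbp, hlt⟩ := exists_box h hs hi
    have hmem : i ∈ rowF s b' J 0 p := mem_rowF.2 (by grind)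
    have hlt' : p + 1 < s → i < b' (p + 1) := fun hh => by
      have : i ≤ b' (p + 1) := hlt _ (Nat.lt_succ_self p) hh
      have := hb _ hh
      omega
    have hmem' : i ∉ rowF s b' J 0 (p + 1) := fun hh => by
      have := lt_of_mem_rowF h hlt' hh (Nat.lt_succ_self p)
      omega
    have hbox : fBoxCol n (rowShape s 0) (rowF s b' J) i p := by
      refine ⟨(plusCol_rowF hn h).2 ⟨hmem, fun hh => ?_⟩, fun c hc => ?_⟩
      · have := (mem_rowF.1 hh).2
        grind
      · obtain ⟨hc, hc'⟩ := (plusCol_rowF hn h).1 hc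
        by_contra hpc
        have := lt_of_mem_rowF h hlt' hc (by omega)
        omega
    rw [fRaw_eq_some hbox hn hmem (hu p), if_neg hmem']
    congr 1
    funext r c
    by_cases hr : r = 0
    · subst hr
      ext v
      simp only [updateBox, true_and]
      split_ifs with h1
      · subst h1
        rw [Finset.mem_insert, Finset.mem_erase, mem_rowF, mem_rowF]
        simp only [Finset.mem_insert, Finset.mem_erase]
        grind
      · rw [mem_rowF, mem_rowF]
        simp only [Finset.mem_insert, Finset.mem_erase]
        have h2 : c < p → p < s → b' (c + 1) ≤ b' p := fun h2 h3 => h.mono _ _ h2 h3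
        have h3 : p < c → c < s → b' (p + 1) ≤ b' c := fun h2 h3 => h.mono _ _ h2 h3
        grind
    · simp [updateBox, hr, rowF_of_ne_zero]

theorem eRaw_rowF_none (hn : 0 < n) (h : IsHookData n s k b J)
    (hno : ¬ ((i + 1 ∈ J ∧ (∀ c, c < s → b c ≠ i) ∧ i ∉ J) ∨ ∃ c, c < s ∧ b c = i + 1)) :
    eRaw n (rowShape s) i (rowF s b J) = none := by
  refine eRaw_eq_none fun c hc => hno ?_
  obtain ⟨hc, hc'⟩ := (minusCol_rowF hn h).1 hc
  rw [mem_rowF] at hc hc'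
  obtain ⟨hcs, hc⟩ := hc
  by_cases hex : ∃ c, c < s ∧ b c = i + 1
  · exact Or.inr hex
  · push Not at hex
    have hbc : i + 1 ∈ J ∧ b c < i + 1 ∧ (c + 1 < s → i + 1 ≤ b (c + 1)) := by
      have := hex c hcs
      grind
    refine Or.inl ⟨hbc.1, fun d hd hbd => ?_, fun hiJ => hc' ⟨hcs, ?_⟩⟩
    · have h1 : d ≤ c := by
        by_contra hlt
        have := h.mono (c + 1) d (by omega) hd
        have := hbc.2.2 (by omega)
        omega
      have := h.mono d c h1 hcs
      exact hc' ⟨hcs, Or.inl (by omega)⟩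
    · grind

theorem eRaw_rowF_some (hn : 0 < n) (hs : 0 < s) (hin : i < n) (h : IsHookData n s k b J)
    (hst : Step s i b J b' J') :
    eRaw n (rowShape s) i (rowF s b' J') = some (rowF s b J) := by
  have h' := hst.isHookData hin h
  have hu : ∀ c r', i + 1 ∈ rowF s b' J' r' c → r' = 0 := fun c r' hr => by
    by_contra hne
    simp [rowF_of_ne_zero hne] at hr
  rcases hst with ⟨p, hp, hbp, hlt, hJ, rfl, rfl⟩ | ⟨hb, hi, hi', rfl, rfl⟩
  · have hmem : i + 1 ∈ rowF s (Function.update b p (i + 1)) J' 0 p :=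
      mem_rowF.2 ⟨hp, Or.inl (by simp)⟩
    have hle : ∀ c, c < p → b c ≤ i := fun c hc => hbp ▸ h.mono c p hc.le hp
    have hbox : eBoxCol n (rowShape s 0) (rowF s (Function.update b p (i + 1)) J') i p := by
      refine ⟨(minusCol_rowF hn h').2 ⟨hmem, fun hh => ?_⟩, fun c hc => ?_⟩
      · have := (mem_rowF.1 hh).2
        rw [Function.update_self] at this
        omega
      · obtain ⟨hc, hc'⟩ := (minusCol_rowF hn h').1 hc
        by_contra hpc
        rw [mem_rowF] at hc hc'
        have h1 := hle c (by omega)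
        have h2 := hle (c + 1)
        have h3 := h.mono c (c + 1) (by omega)
        simp only [Function.update_apply] at hc hc'
        grind
    rw [eRaw_eq_some hbox hn hmem (hu p)]
    congr 1
    funext r c
    by_cases hr : r = 0
    · subst hr
      ext v
      by_cases hiJ : i + 1 ∈ J'
      · have hp0 : 0 < p := by
          rcases hJ hiJ with hh | hh
          · by_contra h0
            have := (h.leg _ hh).1
            have h0 : p = 0 := by omega
            subst h0; omega
          · exact hh.1
        obtain ⟨p, rfl⟩ : ∃ q, p = q + 1 := ⟨p - 1, by omega⟩
        have hle' := hle p (by omega)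
        simp only [Nat.add_sub_cancel] at hJ ⊢
        have hmem' : i + 1 ∈ rowF s (Function.update b (p + 1) (i + 1)) J' 0 p :=
          mem_rowF.2 (by simp only [Function.update_apply]; grind)
        rw [if_pos ⟨hp0, hmem'⟩]
        simp only [updateBox, true_and]
        rcases lt_trichotomy c p with hcp | rfl | hcp
        · rw [if_neg (by omega), if_neg (by omega), mem_rowF, mem_rowF]
          simp [show c ≠ p + 1 by omega, show c ≠ p by omega]
        · rw [if_neg (by omega), if_pos rfl, Finset.mem_erase, mem_rowF, mem_rowF]
          simp only [Function.update_apply]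
          grind
        · split_ifs with h1 h2
          · subst h1
            rw [Finset.mem_insert, mem_rowF, mem_rowF]
            simp only [Function.update_apply]
            grind
          · omega
          · rw [mem_rowF, mem_rowF]
            simp [h1, show c ≠ p by omega]
      · rw [if_neg]
        · simp only [updateBox, true_and]
          split_ifs with h1
          · subst h1
            rw [Finset.mem_insert, Finset.mem_erase, mem_rowF, mem_rowF]
            simp only [Function.update_apply]
            grind
          · rw [mem_rowF, mem_rowF]
            simp only [Function.update_apply]
            grind
        · rintro ⟨hp0, hh⟩
          have := hle (p - 1) (by omega)
          rw [mem_rowF, Function.update_of_ne (by omega)] at hh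
          grind
    · split_ifs <;> simp [updateBox, hr, rowF_of_ne_zero]
  · obtain ⟨p, hp, hbp, hlt⟩ := exists_box h hs hi
    have hlt' : p + 1 < s → i < b' (p + 1) := fun hh => by
      have : i ≤ b' (p + 1) := hlt _ (Nat.lt_succ_self p) hh
      have := hb _ hh
      omega
    have hmem : i + 1 ∈ rowF s b' (insert (i + 1) (J.erase i)) 0 p :=
      mem_rowF.2 ⟨hp, Or.inr ⟨by simp, by omega, hlt'⟩⟩
    have hle : ∀ c, c < p → i + 1 ∉ rowF s b' (insert (i + 1) (J.erase i)) 0 c := fun c hc hh => by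
      have := rowF_le h' hc hh (mem_rowF.2 ⟨hp, Or.inl rfl⟩)
      omega
    have hbox : eBoxCol n (rowShape s 0) (rowF s b' (insert (i + 1) (J.erase i))) i p := by
      refine ⟨(minusCol_rowF hn h').2 ⟨hmem, fun hh => ?_⟩, fun c hc => ?_⟩
      · have hh := (mem_rowF.1 hh).2
        have := hb p hp
        simp only [Finset.mem_insert, Finset.mem_erase] at hh
        omega
      · by_contra hpc
        exact hle c (by omega) ((minusCol_rowF hn h').1 hc).1
    rw [eRaw_eq_some hbox hn hmem (hu p), if_neg fun hh => hle _ (by omega) hh.2]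
    congr 1
    funext r c
    by_cases hr : r = 0
    · subst hr
      ext v
      simp only [updateBox, true_and]
      split_ifs with h1
      · subst h1
        rw [Finset.mem_insert, Finset.mem_erase, mem_rowF, mem_rowF]
        simp only [Finset.mem_insert, Finset.mem_erase]
        grind
      · rw [mem_rowF, mem_rowF]
        simp only [Finset.mem_insert, Finset.mem_erase]
        have h2 : c < p → p < s → b' (c + 1) ≤ b' p := fun h2 h3 => h.mono _ _ h2 h3
        have h3 : p < c → c < s → b' (p + 1) ≤ b' c := fun h2 h3 => h.mono _ _ h2 h3
        grind
    · simp [updateBox, hr, rowF_of_ne_zero]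

/-! ### Hook tableaux -/

theorem rank_lt_card {v : ℕ} (hv : v ∈ J) : rank J v < J.card :=
  Finset.card_lt_card ⟨Finset.filter_subset _ _, fun hh => by simpa using hh hv⟩

theorem rank_lt_rank {v w : ℕ} (hv : v ∈ J) (hvw : v < w) : rank J v < rank J w := by
  refine Finset.card_lt_card ⟨fun x hx => ?_, fun hh => ?_⟩
  · simp only [Finset.mem_filter] at hx ⊢
    exact ⟨hx.1, hx.2.trans hvw⟩
  · simpa using hh (Finset.mem_filter.2 ⟨hv, hvw⟩)

theorem lt_of_rank_lt {v w : ℕ} (hw : w ∈ J) (h : rank J v < rank J w) : v < w := by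
  by_contra hle
  rcases (not_lt.1 hle).eq_or_lt with rfl | hlt
  · omega
  · have := rank_lt_rank hw hlt
    omega

theorem rank_inj {v w : ℕ} (hv : v ∈ J) (hw : w ∈ J) (h : rank J v = rank J w) : v = w := by
  rcases lt_trichotomy v w with hlt | rfl | hlt
  · have := rank_lt_rank hv hlt; omega
  · rfl
  · have := rank_lt_rank hw hlt; omega

theorem exists_rank_eq {r : ℕ} (hr : r < J.card) : ∃ v ∈ J, rank J v = r := by
  have : J.image (rank J) = Finset.range J.card := by
    refine Finset.eq_of_subset_of_card_le (fun x hx => ?_) ?_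
    · obtain ⟨v, hv, rfl⟩ := Finset.mem_image.1 hx
      exact Finset.mem_range.2 (rank_lt_card hv)
    · rw [Finset.card_range, Finset.card_image_of_injOn fun v hv w hw => rank_inj hv hw]
  rw [← Finset.mem_range, ← this] at hr
  exact Finset.mem_image.1 hr

theorem rank_swap_self {x y : ℕ} (hxy : ∀ w ∈ J, w ≠ x → (w < x ↔ w < y)) :
    rank (insert y (J.erase x)) y = rank J x := by
  unfold rank
  congr 1
  ext w
  simp only [Finset.mem_filter, Finset.mem_insert, Finset.mem_erase]
  grind

theorem rank_swap_of_ne {x y w : ℕ} (hx : x ∈ J) (hy : y ∉ J)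
    (hxy : ∀ w ∈ J, w ≠ x → (w < x ↔ w < y)) (hw : w ∈ J) (hwx : w ≠ x) :
    rank (insert y (J.erase x)) w = rank J w := by
  have hwy : w ≠ y := fun hh => hy (hh ▸ hw)
  have := hxy w hw hwx
  unfold rank
  by_cases hlt : x < w
  · have : (insert y (J.erase x)).filter (· < w) = insert y ((J.filter (· < w)).erase x) := by
      ext v
      simp only [Finset.mem_filter, Finset.mem_insert, Finset.mem_erase]
      grind
    have hxm : x ∈ J.filter (· < w) := by simp [hx, hlt]
    rw [this, Finset.card_insert_of_notMem (by simp [hy]), Finset.card_erase_of_mem hxm]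
    have := Finset.card_pos.2 ⟨x, hxm⟩
    omega
  · congr 1
    ext v
    simp only [Finset.mem_filter, Finset.mem_insert, Finset.mem_erase]
    grind

theorem mem_hookF {r c v : ℕ} : v ∈ hookF s b J r c ↔
    (r = 0 ∧ c < s ∧ v = b c) ∨ (r ≠ 0 ∧ c = 0 ∧ v ∈ J ∧ rank J v + 1 = r) := by
  unfold hookF; split_ifs <;> simp_all

theorem hookF_swap {x y : ℕ} (hx : x ∈ J) (hy : y ∉ J)
    (hxy : ∀ w ∈ J, w ≠ x → (w < x ↔ w < y)) :
    hookF s b (insert y (J.erase x)) = updateBox (hookF s b J) (rank J x + 1) 0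
      (insert y ((hookF s b J (rank J x + 1) 0).erase x)) := by
  have h1 := rank_swap_self hxy
  have h2 := fun w => rank_swap_of_ne (w := w) hx hy hxy
  have h3 := fun w hw => rank_inj (v := w) (w := x) (J := J) hw hx
  funext r c
  ext v
  simp only [updateBox]
  split_ifs with h
  · simp only [Finset.mem_insert, Finset.mem_erase, mem_hookF]
    grind
  · simp only [mem_hookF, Finset.mem_insert, Finset.mem_erase]
    grind

theorem hookF_update {p x : ℕ} (hp : p < s) :
    hookF s (Function.update b p x) J =
      updateBox (hookF s b J) 0 p (insert x ((hookF s b J 0 p).erase (b p))) := by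
  funext r c
  ext v
  simp only [updateBox]
  split_ifs with h
  · simp only [Finset.mem_insert, Finset.mem_erase, mem_hookF, Function.update_apply]
    grind
  · simp only [mem_hookF, Function.update_apply]
    grind

theorem colHas_hookF (hkn : k ≤ n) (h : IsHookData n s k b J) {c a : ℕ} :
    colHas n (hookF s b J) a c ↔ (c < s ∧ a = b c) ∨ (c = 0 ∧ a ∈ J) := by
  have hk := h.card
  constructor
  · rintro ⟨r, -, hr⟩
    rw [mem_hookF] at hr
    tauto
  · rintro (hh | ⟨rfl, ha⟩)
    · exact ⟨0, by omega, mem_hookF.2 (Or.inl ⟨rfl, hh⟩)⟩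
    · have := rank_lt_card ha
      exact ⟨rank J a + 1, by omega, mem_hookF.2 (Or.inr ⟨by omega, rfl, ha, rfl⟩)⟩

theorem plusCol_hookF (hkn : k ≤ n) (hs : 0 < s) (h : IsHookData n s k b J) {c : ℕ} :
    PlusCol n (hookShape s (k - 1) 0) (hookF s b J) i c ↔ c < s ∧
      ((c = 0 ∧ (i = b 0 ∨ i ∈ J) ∧ i + 1 ∉ J ∧ i + 1 ≠ b 0) ∨
        (0 < c ∧ b c = i ∧ (i + 1 ∈ J → i ∈ J ∨ b (c - 1) = i))) := by
  simp only [PlusCol, colSign_eq_true, colHas_hookF hkn h, hookShape, if_true]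
  refine and_congr_right fun hcs => ?_
  rcases Nat.eq_zero_or_pos c with rfl | hc
  · simp [colWordBefore, mctr, hs]; tauto
  have key : b c = i → (mctr (colWordBefore n (hookF s b J) i c) = 0 ↔
      (i + 1 ∈ J → i ∈ J ∨ b (c - 1) = i)) := fun hbc => by
    have hle : ∀ d, d < c → b d ≤ i := fun d hd => hbc ▸ h.mono d c hd.le hcs
    obtain ⟨c, rfl⟩ : ∃ q, c = q + 1 := ⟨c - 1, by omega⟩
    have hsplit : colWordBefore n (hookF s b J) i (c + 1) =
        (List.map Nat.succ (List.range c)).filterMap (colSign n (hookF s b J) i) ∨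
        colWordBefore n (hookF s b J) i (c + 1) = true ::
        (List.map Nat.succ (List.range c)).filterMap (colSign n (hookF s b J) i) ∨
        (colSign n (hookF s b J) i 0 = some false ∧
        colWordBefore n (hookF s b J) i (c + 1) = false ::
        (List.map Nat.succ (List.range c)).filterMap (colSign n (hookF s b J) i)) := by
      unfold colWordBefore
      rw [List.range_succ_eq_map, List.filterMap_cons]
      rcases colSign n (hookF s b J) i 0 with _ | _ | _ <;> simp
    have hall : ∀ x ∈ (List.map Nat.succ (List.range c)).filterMap (colSign n (hookF s b J) i),
        x = true := fun x hx => by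
      obtain ⟨d, hd, hx⟩ := List.mem_filterMap.1 hx
      simp only [List.mem_map, List.mem_range] at hd
      obtain ⟨d, hd, rfl⟩ := hd
      cases x with
      | true => rfl
      | false =>
        rw [colSign_eq_false, colHas_hookF hkn h] at hx
        have := hle (d + 1) (by omega)
        simp at hx
        omega
    by_cases hsgn : colSign n (hookF s b J) i 0 = some false
    · have hw : colWordBefore n (hookF s b J) i (c + 1) = false ::
        (List.map Nat.succ (List.range c)).filterMap (colSign n (hookF s b J) i) := by
        unfold colWordBefore
        rw [List.range_succ_eq_map, List.filterMap_cons, hsgn]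
      rw [hw, mctr_false_cons _ hall]
      rw [colSign_eq_false, colHas_hookF hkn h, colHas_hookF hkn h] at hsgn
      have := hle 0 (by omega)
      have hJ : i + 1 ∈ J ∧ i ∉ J ∧ b 0 ≠ i := by grind
      simp only [hJ.1, hJ.2.1, false_or, forall_const]
      rw [Nat.sub_eq_zero_iff_le, Nat.one_le_iff_ne_zero, Ne, List.length_eq_zero_iff,
        List.filterMap_eq_nil_iff]
      constructor
      · intro hne
        by_contra hcon
        refine hne fun d hd => ?_
        simp only [List.mem_map, List.mem_range] at hd
        obtain ⟨d, hd, rfl⟩ := hd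
        have h1 := h.mono (d + 1) c hd (by omega)
        have h2 := hle c (by omega)
        simp only [Nat.add_sub_cancel] at hcon
        rw [colSign, if_neg, if_neg] <;>
          simp only [colHas_hookF hkn h, Nat.succ_eq_add_one] <;> omega
      · intro hbi hne
        simp only [Nat.add_sub_cancel] at hbi
        have hc0 : c ≠ 0 := by rintro rfl; exact hJ.2.2 hbi
        have := hne c (List.mem_map.2 ⟨c - 1, List.mem_range.2 (by omega), by omega⟩)
        simp [colSign, colHas_hookF hkn h, hbi, hc0] at this
        omega
    · refine ⟨fun _ hJ => ?_, fun _ => mctr_of_all_true _ fun x hx => ?_⟩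
      · rw [colSign_eq_false, colHas_hookF hkn h, colHas_hookF hkn h] at hsgn
        have h0 : i ∈ J ∨ b 0 = i := by grind
        refine h0.imp_right fun h0 => ?_
        have := h.mono 0 c (by omega) (by omega)
        have := hle c (by omega)
        simp only [Nat.add_sub_cancel]
        omega
      · rcases hsplit with hw | hw | hw
        · exact hall x (hw ▸ hx)
        · rw [hw, List.mem_cons] at hx
          exact hx.elim id (hall x)
        · exact absurd hw.1 hsgn
  grind

theorem minusCol_hookF (hkn : k ≤ n) (hs : 0 < s) (h : IsHookData n s k b J) {c : ℕ} :
    MinusCol n (hookShape s (k - 1) 0) (hookF s b J) i c ↔ c < s ∧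
      ((c = 0 ∧ (i + 1 = b 0 ∨ i + 1 ∈ J) ∧ i ∉ J ∧ ∀ d, d < s → b d ≠ i) ∨
        (0 < c ∧ b c = i + 1)) := by
  simp only [MinusCol, colSign_eq_false, colHas_hookF hkn h, hookShape, if_true]
  refine and_congr_right fun hcs => ?_
  rcases Nat.eq_zero_or_pos c with rfl | hc
  · have key : pctr (colWordAfter n s (hookF s b J) i 0) = 0 ↔ ∀ d, 0 < d → d < s → b d ≠ i := by
      constructor
      · intro h0 d hd hds hbd
        refine pctr_ne_zero ?_ (mem_colWordAfter.2 ⟨d, hd, hds, ?_⟩) h0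
        · rw [colWordAfter, drop_range, List.pairwise_filterMap]
          refine (List.pairwise_lt_range' (s := 0 + 1) (n := s - (0 + 1))).imp_of_mem ?_
          intro x y hx hy hxy u hu v hv hvt
          simp only [List.mem_range'_1] at hx hy
          subst hvt
          cases u with
          | true => rfl
          | false =>
            rw [colSign_eq_false, colHas_hookF hkn h] at hu
            rw [colSign_eq_true, colHas_hookF hkn h] at hv
            have := h.mono x y hxy.le (by omega)
            omega
        · rw [colSign_eq_true, colHas_hookF hkn h, colHas_hookF hkn h]
          omega
      · intro hne
        refine pctr_of_all_false _ fun x hx => ?_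
        obtain ⟨d, hd, hds, hx⟩ := mem_colWordAfter.1 hx
        cases x with
        | false => rfl
        | true =>
          rw [colSign_eq_true, colHas_hookF hkn h] at hx
          have := hne d hd hds
          omega
    rw [key]
    have : (∀ d, d < s → b d ≠ i) ↔ b 0 ≠ i ∧ ∀ d, 0 < d → d < s → b d ≠ i := by
      constructor
      · exact fun hh => ⟨hh 0 hs, fun d _ => hh d⟩
      · rintro ⟨h0, h1⟩ d hd
        rcases Nat.eq_zero_or_pos d with rfl | hd0
        · exact h0
        · exact h1 d hd0 hd
    rw [this]
    simp [hs]
    tauto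
  · have key : b c = i + 1 → pctr (colWordAfter n s (hookF s b J) i c) = 0 := fun hbc => by
      refine pctr_of_all_false _ fun x hx => ?_
      obtain ⟨d, hd, hds, hx⟩ := mem_colWordAfter.1 hx
      cases x with
      | false => rfl
      | true =>
        rw [colSign_eq_true, colHas_hookF hkn h] at hx
        have := h.mono c d hd.le hds
        omega
    grind

theorem fRaw_hookF_none (hkn : k ≤ n) (hs : 0 < s) (h : IsHookData n s k b J)
    (hno : ¬ ∃ b' J', Step s i b J b' J') :
    fRaw n (hookShape s (k - 1)) i (hookF s b J) = none := by
  refine fRaw_eq_none fun c hc => hno ?_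
  obtain ⟨hcs, hc⟩ := (plusCol_hookF hkn hs h).1 hc
  by_cases hex : ∃ c, c < s ∧ b c = i
  · obtain ⟨p, hp, hbp, hlt⟩ := exists_max h hex
    refine ⟨_, _, Or.inl ⟨p, hp, hbp, hlt, fun hJ => ?_, rfl, rfl⟩⟩
    rcases hc with hc | ⟨hc0, hbc, hc⟩
    · exact absurd hJ hc.2.2.1
    refine (hc hJ).imp_right fun hc => ?_
    have h1 : c ≤ p := by
      by_contra hlt'
      have := h.mono (p + 1) c (by omega) hcs
      have := hlt (by omega)
      omega
    have := h.mono (c - 1) (p - 1) (by omega) (by omega)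
    have := h.mono (p - 1) p (by omega) (by omega)
    omega
  · push Not at hex
    have := hex c hcs
    have := hex 0 hs
    exact ⟨_, _, Or.inr ⟨hex, by grind, by grind, rfl, rfl⟩⟩

theorem eRaw_hookF_none (hkn : k ≤ n) (hs : 0 < s) (h : IsHookData n s k b J)
    (hno : ¬ ((i + 1 ∈ J ∧ (∀ c, c < s → b c ≠ i) ∧ i ∉ J) ∨ ∃ c, c < s ∧ b c = i + 1)) :
    eRaw n (hookShape s (k - 1)) i (hookF s b J) = none := by
  refine eRaw_eq_none fun c hc => hno ?_
  obtain ⟨hcs, hc⟩ := (minusCol_hookF hkn hs h).1 hc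
  grind

theorem fRaw_hookF_some (hkn : k ≤ n) (hs : 0 < s) (h : IsHookData n s k b J)
    (hst : Step s i b J b' J') :
    fRaw n (hookShape s (k - 1)) i (hookF s b J) = some (hookF s b' J') := by
  have hk := h.card
  rcases hst with ⟨p, hp, hbp, hlt, hJ, rfl, rfl⟩ | ⟨hb, hi, hi', rfl, rfl⟩
  · have hmax : ∀ c, p < c → c < s → i < b c := fun c hc hcs => by
      have := h.mono (p + 1) c hc hcs
      have := hlt (by omega)
      omega
    have hp0 : p = 0 → i ∉ J' := fun h0 hh => by
      subst h0
      have := (h.leg _ hh).1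
      omega
    have hbox : fBoxCol n (hookShape s (k - 1) 0) (hookF s b J') i p := by
      refine ⟨(plusCol_hookF hkn hs h).2 ⟨hp, ?_⟩, fun c hc => ?_⟩
      · rcases Nat.eq_zero_or_pos p with rfl | hpos
        · grind
        · grind
      · obtain ⟨hcs, hc⟩ := (plusCol_hookF hkn hs h).1 hc
        by_contra hpc
        have := hmax c (by omega) hcs
        omega
    rw [fRaw_eq_some hbox (by omega) (mem_hookF.2 (Or.inl ⟨rfl, hp, hbp.symm⟩)), if_neg,
      hookF_update hp, hbp]
    · rw [mem_hookF]
      rintro (⟨-, h1, h2⟩ | hh)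
      · have := hmax _ (Nat.lt_succ_self p) h1
        simp only [Nat.succ_eq_add_one] at this
        omega
      · exact hh.1 rfl
    · intro r' hr'
      rw [mem_hookF] at hr'
      by_contra hne
      grind
  · have hbox : fBoxCol n (hookShape s (k - 1) 0) (hookF s b' J) i 0 := by
      refine ⟨(plusCol_hookF hkn hs h).2 ⟨hs, Or.inl ⟨rfl, Or.inr hi, hi', ?_⟩⟩, fun c hc => ?_⟩
      · have := (h.leg i hi).1
        omega
      · obtain ⟨hcs, hc⟩ := (plusCol_hookF hkn hs h).1 hc
        have := hb c hcs
        omega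
    have := rank_lt_card hi
    have hb0 := hb 0 hs
    rw [fRaw_eq_some hbox (r := rank J i + 1) (by omega)
      (mem_hookF.2 (Or.inr ⟨by omega, rfl, hi, rfl⟩)), if_neg, hookF_swap hi hi']
    · intro w hw hwi
      have : w ≠ i + 1 := fun hh => hi' (hh ▸ hw)
      omega
    · rw [mem_hookF]
      omega
    · intro r' hr'
      rw [mem_hookF] at hr'
      grind

theorem eRaw_hookF_some (hkn : k ≤ n) (hs : 0 < s) (hin : i < n) (h : IsHookData n s k b J)
    (hst : Step s i b J b' J') :
    eRaw n (hookShape s (k - 1)) i (hookF s b' J') = some (hookF s b J) := by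
  have hk := h.card
  have h' := hst.isHookData hin h
  rcases hst with ⟨p, hp, hbp, hlt, hJ, rfl, rfl⟩ | ⟨hb, hi, hi', rfl, rfl⟩
  · have hle : ∀ c, c < p → b c ≤ i := fun c hc => hbp ▸ h.mono c p hc.le hp
    have hself : Function.update b p (i + 1) p = i + 1 := Function.update_self ..
    have hne : ∀ c, c ≠ p → Function.update b p (i + 1) c = b c :=
      fun c hc => Function.update_of_ne hc ..
    have hback : Function.update (Function.update b p (i + 1)) p i = b := by
      simp [← hbp]
    have hbox :
        eBoxCol n (hookShape s (k - 1) 0) (hookF s (Function.update b p (i + 1)) J') i p := by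
      refine ⟨(minusCol_hookF hkn hs h').2 ⟨hp, ?_⟩, fun c hc => ?_⟩
      · rcases Nat.eq_zero_or_pos p with rfl | hpos
        · refine Or.inl ⟨rfl, Or.inl hself.symm, fun hh => ?_, fun d hd => ?_⟩
          · have := (h.leg _ hh).1
            omega
          · rcases Nat.eq_zero_or_pos d with rfl | hd0
            · omega
            · rw [hne d (by omega)]
              have := h.mono 1 d hd0 hd
              have := hlt (by omega)
              simp only [Nat.zero_add] at this
              omega
        · exact Or.inr ⟨hpos, hself⟩
      · obtain ⟨hcs, hc⟩ := (minusCol_hookF hkn hs h').1 hc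
        by_contra hpc
        have h1 := hne c (by omega)
        have h2 := hle c (by omega)
        have h3 := hne (p - 1) (by omega)
        have h4 := hle 0 (by omega)
        have h5 := hne 0 (by omega)
        grind
    rw [eRaw_eq_some hbox (by omega) (mem_hookF.2 (Or.inl ⟨rfl, hp, hself.symm⟩)), if_neg]
    · conv_rhs => rw [← hback, hookF_update hp, hself]
    · rintro ⟨h0, hh⟩
      rw [mem_hookF, hne _ (by omega)] at hh
      have := hle (p - 1) (by omega)
      omega
    · intro r' hr'
      rw [mem_hookF] at hr'
      by_contra hr0
      have : p = 0 ∧ i + 1 ∈ J' := by tauto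
      obtain ⟨rfl, hh⟩ := this
      have := (h'.leg _ hh).1
      omega
  · have hmem : i + 1 ∈ insert (i + 1) (J.erase i) := by simp
    have hnmem : i ∉ insert (i + 1) (J.erase i) := by simp
    have hback : insert i ((insert (i + 1) (J.erase i)).erase (i + 1)) = J := by
      ext v; simp only [Finset.mem_insert, Finset.mem_erase]; grind
    have hlt : ∀ w ∈ insert (i + 1) (J.erase i), w ≠ i + 1 → (w < i + 1 ↔ w < i) := by
      intro w hw hwi
      have : w ≠ i := fun hh => hnmem (hh ▸ hw)
      omega
    have hk' := h'.card
    have hleg := h'.leg _ hmem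
    generalize insert (i + 1) (J.erase i) = K at *
    have hbox : eBoxCol n (hookShape s (k - 1) 0) (hookF s b' K) i 0 :=
      ⟨(minusCol_hookF hkn hs h').2 ⟨hs, Or.inl ⟨rfl, Or.inr hmem, hnmem, hb⟩⟩,
        fun c _ => Nat.zero_le c⟩
    have := rank_lt_card hmem
    rw [eRaw_eq_some hbox (r := rank K (i + 1) + 1) (by omega)
      (mem_hookF.2 (Or.inr ⟨by omega, rfl, hmem, rfl⟩)), if_neg (by omega), ← hback,
      hookF_swap hmem hnmem hlt]
    intro r' hr'
    rw [mem_hookF] at hr'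
    grind

theorem isSSYT_hookF (h : IsHookData n s k b J) :
    IsSSYT n (hookShape s (k - 1)) (hookF s b J) := by
  have hk := h.card
  refine ⟨⟨fun r c hc => ?_, fun r c hc => ?_, fun r c a ha => ?_, fun r c x y hx hy => ?_,
    fun r c x y hx hy => ?_⟩, fun r c hc => ?_⟩
  · by_cases hr : r = 0
    · subst hr
      exact ⟨b c, mem_hookF.2 (Or.inl ⟨rfl, by simpa [hookShape] using hc, rfl⟩)⟩
    · simp only [hookShape, hr, if_false] at hc
      split_ifs at hc
      · obtain ⟨v, hv, hvr⟩ := exists_rank_eq (J := J) (r := r - 1) (by omega)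
        exact ⟨v, mem_hookF.2 (Or.inr ⟨hr, by omega, hv, by omega⟩)⟩
      · omega
  · by_contra hne
    obtain ⟨v, hv⟩ := Finset.nonempty_iff_ne_empty.2 hne
    refine hc ?_
    rcases mem_hookF.1 hv with ⟨rfl, hh, -⟩ | ⟨hr, rfl, hJ, hh⟩
    · simpa [hookShape] using hh
    · have := rank_lt_card hJ
      simp only [hookShape, hr, if_false]
      rw [if_pos (by omega)]
      omega
  · rcases mem_hookF.1 ha with ⟨rfl, hh, rfl⟩ | ⟨hr, rfl, hJ, hh⟩
    · exact h.bounds c hh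
    · have := h.leg a hJ
      omega
  · rw [mem_hookF] at hx hy
    rcases hy with ⟨rfl, hh, rfl⟩ | hy
    · have := h.mono c (c + 1) (by omega) hh
      omega
    · omega
  · rw [mem_hookF] at hx hy
    rcases hy with hy | ⟨-, rfl, hJ, hy⟩
    · omega
    · rcases hx with ⟨rfl, -, rfl⟩ | ⟨-, -, hJ', hx⟩
      · exact (h.leg y hJ).1
      · exact lt_of_rank_lt hJ (by omega)
  · by_cases hr : r = 0
    · subst hr
      simp only [hookShape, if_true] at hc
      simp [hookF, hc]
    · simp only [hookShape, hr, if_false] at hc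
      split_ifs at hc
      · obtain ⟨v, hv, hvr⟩ := exists_rank_eq (J := J) (r := r - 1) (by omega)
        refine Finset.card_eq_one.2 ⟨v, Finset.ext fun w => ?_⟩
        rw [mem_hookF, Finset.mem_singleton]
        constructor
        · rintro (hw | ⟨-, -, hw, hwr⟩)
          · omega
          · exact rank_inj hw hv (by omega)
        · rintro rfl
          exact Or.inr ⟨hr, by omega, hv, by omega⟩
      · omega

theorem exists_eq_hookF (hk1 : 1 ≤ k) (hs : 0 < s) {u : Filling}
    (hu : IsSSYT n (hookShape s (k - 1)) u) :
    ∃ b J, IsHookData n s k b J ∧ u = hookF s b J := by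
  obtain ⟨⟨-, h2, h3, h4, h5⟩, h6⟩ := hu
  have hex : ∀ r c, ∃ x, c < hookShape s (k - 1) r → u r c = {x} := fun r c => by
    by_cases hc : c < hookShape s (k - 1) r
    · obtain ⟨x, hx⟩ := Finset.card_eq_one.1 (h6 r c hc)
      exact ⟨x, fun _ => hx⟩
    · exact ⟨0, fun hh => absurd hh hc⟩
  choose x hx using hex
  have hx0 : ∀ c, c < s → u 0 c = {x 0 c} := fun c hc => hx 0 c (by simpa [hookShape])
  have hxr : ∀ r, r ≤ k - 1 → u r 0 = {x r 0} := fun r hr => hx r 0 (by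
    unfold hookShape; split_ifs <;> omega)
  have hcol : ∀ d r, r + d + 1 ≤ k - 1 → x r 0 < x (r + d + 1) 0 := fun d => by
    induction d with
    | zero =>
      intro r hr
      exact h5 r 0 _ _ (by simp [hxr r (by omega)]) (by simp [hxr (r + 1) (by omega)])
    | succ d ih =>
      intro r hr
      exact (ih r (by omega)).trans
        (h5 (r + d + 1) 0 _ _ (by simp [hxr _ (show r + d + 1 ≤ k - 1 by omega)])
          (by
            show x (r + d + 1 + 1) 0 ∈ u (r + d + 1 + 1) 0
            rw [hxr (r + d + 1 + 1) (by omega)]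
            exact Finset.mem_singleton_self _))
  have hlt : ∀ q r, q < r → r ≤ k - 1 → x q 0 < x r 0 := fun q r hqr hr => by
    have := hcol (r - q - 1) q (by omega)
    rwa [show q + (r - q - 1) + 1 = r by omega] at this
  have hinj : ∀ q r, q ≤ k - 1 → r ≤ k - 1 → x q 0 = x r 0 → q = r := fun q r hq hr he => by
    rcases lt_trichotomy q r with hh | hh | hh
    · have := hlt q r hh hr; omega
    · exact hh
    · have := hlt r q hh hq; omega
  set J := (Finset.Icc 1 (k - 1)).image fun r => x r 0 with hJ
  have hmemJ : ∀ v, v ∈ J ↔ ∃ r, 1 ≤ r ∧ r ≤ k - 1 ∧ x r 0 = v := fun v => by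
    simp [hJ, and_assoc]
  have hrank : ∀ r, 1 ≤ r → r ≤ k - 1 → rank J (x r 0) + 1 = r := fun r hr1 hr => by
    have : J.filter (· < x r 0) = (Finset.Ico 1 r).image fun q => x q 0 := by
      ext v
      simp only [Finset.mem_filter, hmemJ, Finset.mem_image, Finset.mem_Ico]
      constructor
      · rintro ⟨⟨q, hq1, hq, rfl⟩, hqr⟩
        refine ⟨q, ⟨hq1, ?_⟩, rfl⟩
        by_contra hge
        rcases (not_lt.1 hge).eq_or_lt with rfl | hh
        · omega
        · have := hlt r q hh hq; omega
      · rintro ⟨q, ⟨hq1, hq⟩, rfl⟩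
        exact ⟨⟨q, hq1, by omega, rfl⟩, hlt q r hq hr⟩
    rw [rank, this, Finset.card_image_of_injOn, Nat.card_Ico]
    · omega
    · intro q hq q' hq' he
      simp only [Finset.coe_Ico, Set.mem_Ico] at hq hq'
      exact hinj q q' (by omega) (by omega) he
  have hmono : ∀ c d, c ≤ d → d < s → x 0 c ≤ x 0 d := fun c d hcd => by
    induction d, hcd using Nat.le_induction with
    | base => exact fun _ => le_rfl
    | succ d hcd ih =>
      exact fun hd => (ih (by omega)).trans
        (h4 0 d _ _ (by simp [hx0 d (by omega)]) (by simp [hx0 (d + 1) hd]))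
  refine ⟨fun c => if c < s then x 0 c else 0, J, ⟨fun c d hcd hd => ?_, fun c hc => ?_,
    fun c hc => ?_, fun v hv => ?_, ?_⟩, ?_⟩
  · simpa [hd, hcd.trans_lt hd] using hmono c d hcd hd
  · simpa [hc] using h3 0 c (x 0 c) (by simp [hx0 c hc])
  · simp [hc]
  · obtain ⟨r, hr1, hr, rfl⟩ := (hmemJ v).1 hv
    simp only [hs, if_true]
    exact ⟨hlt 0 r hr1 hr, (h3 r 0 _ (by simp [hxr r hr])).2⟩
  · rw [hJ, Finset.card_image_of_injOn, Nat.card_Icc]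
    · omega
    · intro q hq q' hq' he
      simp only [Finset.coe_Icc, Set.mem_Icc] at hq hq'
      exact hinj q q' (by omega) (by omega) he
  · funext r c
    by_cases hc : c < hookShape s (k - 1) r
    · by_cases hr : r = 0
      · subst hr
        simp only [hookShape, if_true] at hc
        simp [hookF, hc, hx0]
      · simp only [hookShape, hr, if_false] at hc
        split_ifs at hc with hrk
        · obtain rfl : c = 0 := by omega
          rw [hxr r hrk]
          ext v
          rw [mem_hookF, Finset.mem_singleton]
          constructor
          · rintro rfl
            exact Or.inr ⟨hr, rfl, (hmemJ _).2 ⟨r, by omega, hrk, rfl⟩, hrank r (by omega) hrk⟩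
          · rintro (hv | ⟨-, -, hv, hvr⟩)
            · omega
            · obtain ⟨q, hq1, hq, rfl⟩ := (hmemJ v).1 hv
              rw [hrank q hq1 hq] at hvr
              rw [hvr]
        · omega
    · rw [h2 r c hc]
      symm
      rw [Finset.eq_empty_iff_forall_notMem]
      intro v hv
      refine hc ?_
      rcases mem_hookF.1 hv with ⟨rfl, hh, -⟩ | ⟨hr, rfl, hv, hvr⟩
      · simpa [hookShape] using hh
      · obtain ⟨q, hq1, hq, rfl⟩ := (hmemJ v).1 hv
        rw [hrank q hq1 hq] at hvr
        subst hvr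
        simp [hookShape, hr, hq]

theorem hookF_injective (h : IsHookData n s k b J) (h' : IsHookData n s k b' J')
    (he : hookF s b J = hookF s b' J') : b = b' ∧ J = J' := by
  have key : ∀ r c v, v ∈ hookF s b J r c ↔ v ∈ hookF s b' J' r c := by simp [he]
  simp only [mem_hookF] at key
  refine ⟨funext fun c => ?_, Finset.ext fun v => ⟨fun hv => ?_, fun hv => ?_⟩⟩
  · by_cases hc : c < s
    · have := (key 0 c (b c)).1 (Or.inl ⟨rfl, hc, rfl⟩)
      omega
    · rw [h.zero c (by omega), h'.zero c (by omega)]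
  · have := (key (rank J v + 1) 0 v).1 (Or.inr ⟨by omega, rfl, hv, rfl⟩)
    tauto
  · have := (key (rank J' v + 1) 0 v).2 (Or.inr ⟨by omega, rfl, hv, rfl⟩)
    tauto

theorem rowF_injective (hs : 0 < s) (h : IsHookData n s k b J) (h' : IsHookData n s k b' J')
    (he : rowF s b J = rowF s b' J') : b = b' ∧ J = J' := by
  have key : ∀ c v, v ∈ rowF s b J 0 c ↔ v ∈ rowF s b' J' 0 c := by simp [he]
  simp only [mem_rowF] at key
  have hb : b = b' := funext fun c => by
    by_cases hc : c < s
    · have := (key c (b c)).1 ⟨hc, Or.inl rfl⟩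
      have := (key c (b' c)).2 ⟨hc, Or.inl rfl⟩
      omega
    · rw [h.zero c (by omega), h'.zero c (by omega)]
  subst hb
  refine ⟨rfl, Finset.ext fun v => ⟨fun hv => ?_, fun hv => ?_⟩⟩
  · obtain ⟨c, hc, hcv, hlt⟩ := exists_box h hs hv
    have := (key c v).1 ⟨hc, Or.inr ⟨hv, hcv, hlt _ (Nat.lt_succ_self c)⟩⟩
    grind
  · obtain ⟨c, hc, hcv, hlt⟩ := exists_box h' hs hv
    have := (key c v).2 ⟨hc, Or.inr ⟨hv, hcv, hlt _ (Nat.lt_succ_self c)⟩⟩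
    grind

/-! ### Weights -/

theorem wt_rowF (hn : 0 < n) (hs : 0 < s) (h : IsHookData n s k b J) (j : ℕ) :
    wt n (rowShape s) (rowF s b J) j =
      ((Finset.range s).filter fun c => b c = j).card + if j ∈ J then 1 else 0 := by
  have hmem : ∀ r c, j ∈ rowF s b J r c ↔ r = 0 ∧ c < s ∧
      (j = b c ∨ (j ∈ J ∧ b c < j ∧ (c + 1 < s → j ≤ b (c + 1)))) := fun r c => by
    by_cases hr : r = 0
    · subst hr
      simp [mem_rowF]
    · simp [rowF_of_ne_zero hr, hr]
  have hinj : Function.Injective fun c : ℕ => ((0 : ℕ), c) := fun c d hcd => by simpa using hcd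
  unfold wt
  split_ifs with hj
  · obtain ⟨p, hp, hpj, hlt⟩ := exists_box h hs hj
    rw [← Finset.card_image_of_injective _ hinj, ← Finset.card_insert_of_notMem (a := (0, p))]
    · congr 1
      ext ⟨r, c⟩
      have h1 := h.mono (c + 1) p
      have h2 := hlt c
      have h3 := hlt (p + 1) (Nat.lt_succ_self p)
      simp only [Finset.mem_filter, Finset.mem_product, Finset.mem_range, hmem,
        rowShape, if_true, Finset.mem_insert, Finset.mem_image, Prod.mk.injEq]
      constructor
      · rintro ⟨-, rfl, hc, hjc | ⟨-, hcj, hjc⟩⟩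
        · exact Or.inr ⟨c, ⟨hc, hjc.symm⟩, rfl, rfl⟩
        · refine Or.inl ⟨rfl, ?_⟩
          omega
      · rintro (⟨rfl, rfl⟩ | ⟨c, ⟨hc, hcj⟩, rfl, rfl⟩)
        · exact ⟨⟨hn, hp⟩, rfl, hp, Or.inr ⟨hj, hpj, h3⟩⟩
        · exact ⟨⟨hn, hc⟩, rfl, hc, Or.inl hcj.symm⟩
    · simp [hpj.ne]
  · rw [← Finset.card_image_of_injective _ hinj, add_zero]
    congr 1
    ext ⟨r, c⟩
    simp only [Finset.mem_filter, Finset.mem_product, Finset.mem_range, hmem,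
      rowShape, if_true, Finset.mem_image, Prod.mk.injEq]
    grind

theorem wt_hookF (hkn : k ≤ n) (hs : 0 < s) (h : IsHookData n s k b J) (j : ℕ) :
    wt n (hookShape s (k - 1)) (hookF s b J) j =
      ((Finset.range s).filter fun c => b c = j).card + if j ∈ J then 1 else 0 := by
  have hk := h.card
  have hinj : Function.Injective fun c : ℕ => ((0 : ℕ), c) := fun c d hcd => by simpa using hcd
  unfold wt
  split_ifs with hj
  · have := rank_lt_card hj
    rw [← Finset.card_image_of_injective _ hinj,
      ← Finset.card_insert_of_notMem (a := (rank J j + 1, 0)) (by simp)]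
    congr 1
    ext ⟨r, c⟩
    simp only [Finset.mem_filter, Finset.mem_product, Finset.mem_range, mem_hookF,
      hookShape, if_true, Finset.mem_insert, Finset.mem_image, Prod.mk.injEq]
    grind
  · rw [← Finset.card_image_of_injective _ hinj, add_zero]
    congr 1
    ext ⟨r, c⟩
    simp only [Finset.mem_filter, Finset.mem_product, Finset.mem_range, mem_hookF,
      hookShape, if_true, Finset.mem_image, Prod.mk.injEq]
    grind

/-! ### The component of `U_μ` -/

theorem Umu_eq_rowF (hk1 : 1 ≤ k) :
    Umu s k = rowF s (fun c => if c < s then 1 else 0) (Finset.Icc 2 k) := by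
  funext r c
  by_cases hr : r = 0
  · subst hr
    ext v
    rw [mem_rowF]
    unfold Umu
    split_ifs <;> simp_all <;> omega
  · simp [Umu, rowF, hr]

theorem isHookData_highest (hk1 : 1 ≤ k) (hkn : k ≤ n) (hs : 0 < s) :
    IsHookData n s k (fun c => if c < s then 1 else 0) (Finset.Icc 2 k) := by
  refine ⟨fun c d hcd hd => ?_, fun c hc => ?_, fun c hc => ?_, fun v hv => ?_, ?_⟩
  · simp [hd, hcd.trans_lt hd]
  · simp only [hc, if_true]; omega
  · simp [hc]
  · simp only [hs, if_true]
    have := Finset.mem_Icc.1 hv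
    omega
  · rw [Nat.card_Icc]; omega

theorem eq_highest (h : IsHookData n s k b J) (hs : 0 < s)
    (hno : ∀ i, 1 ≤ i → i < n →
      ¬ ((i + 1 ∈ J ∧ (∀ c, c < s → b c ≠ i) ∧ i ∉ J) ∨ ∃ c, c < s ∧ b c = i + 1)) :
    b = (fun c => if c < s then 1 else 0) ∧ J = Finset.Icc 2 k := by
  have hk := h.card
  have hb : ∀ c, c < s → b c = 1 := fun c hc => by
    by_contra hne
    have := h.bounds c hc
    exact hno (b c - 1) (by omega) (by omega) (Or.inr ⟨c, hc, by omega⟩)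
  refine ⟨funext fun c => ?_, ?_⟩
  · split_ifs with hc
    · exact hb c hc
    · exact h.zero c (by omega)
  have hdown : ∀ d w, 2 ≤ w → w + d ∈ J → w ∈ J := fun d => by
    induction d with
    | zero => exact fun w _ hw => hw
    | succ d ih =>
      intro w hw hwd
      refine ih w hw ?_
      by_contra hcon
      have := (h.leg _ hwd).2
      refine hno (w + d) (by omega) (by omega) (Or.inl ⟨hwd, fun c hc => ?_, hcon⟩)
      rw [hb c hc]; omega
  symm
  refine Finset.eq_of_subset_of_card_le (fun w hw => ?_) (by rw [Nat.card_Icc]; omega)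
  have hw := Finset.mem_Icc.1 hw
  by_contra hwJ
  have hsub : J ⊆ Finset.Ico 2 w := fun v hv => by
    have h1 := (h.leg v hv).1
    rw [hb 0 hs] at h1
    refine Finset.mem_Ico.2 ⟨h1, ?_⟩
    by_contra hge
    exact hwJ (hdown (v - w) w hw.1 (by rwa [Nat.add_sub_of_le (by omega)]))
  have := Finset.card_le_card hsub
  rw [Nat.card_Ico] at this
  omega

theorem reach_rowF (hk1 : 1 ≤ k) (hn : 0 < n) (hs : 0 < s) (h : IsHookData n s k b J) :
    Reach n (rowShape s) (Umu s k) (rowF s b J) := by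
  induction hm : ∑ c ∈ Finset.range s, b c + ∑ v ∈ J, v using Nat.strong_induction_on
    generalizing b J with
  | _ m ih =>
  by_cases hno : ∀ i, 1 ≤ i → i < n →
      ¬ ((i + 1 ∈ J ∧ (∀ c, c < s → b c ≠ i) ∧ i ∉ J) ∨ ∃ c, c < s ∧ b c = i + 1)
  · obtain ⟨rfl, rfl⟩ := eq_highest h hs hno
    rw [← Umu_eq_rowF hk1]
    exact .base
  · push Not at hno
    obtain ⟨i, hi1, hin, hc⟩ := hno
    obtain ⟨b', J', h', hst, hlt⟩ := exists_step hi1 h hc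
    exact .stepF i hi1 hin (ih _ (hm ▸ hlt) h' rfl) (fRaw_rowF_some hn hs h' hst)

theorem Reach.exists_rowF (hk1 : 1 ≤ k) (hkn : k ≤ n) (hs : 0 < s) {t : Filling}
    (ht : Reach n (rowShape s) (Umu s k) t) : ∃ b J, IsHookData n s k b J ∧ t = rowF s b J := by
  have hn : 0 < n := by omega
  induction ht with
  | base => exact ⟨_, _, isHookData_highest hk1 hkn hs, Umu_eq_rowF hk1⟩
  | stepF i hi1 hin _ hf ih =>
    obtain ⟨b, J, h, rfl⟩ := ih
    by_cases hst : ∃ b' J', Step s i b J b' J'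
    · obtain ⟨b', J', hst⟩ := hst
      rw [fRaw_rowF_some hn hs h hst, Option.some_inj] at hf
      exact ⟨b', J', hst.isHookData hin h, hf.symm⟩
    · simp [fRaw_rowF_none hn h hst] at hf
  | stepE i hi1 hin _ he ih =>
    obtain ⟨b, J, h, rfl⟩ := ih
    by_cases hc : (i + 1 ∈ J ∧ (∀ c, c < s → b c ≠ i) ∧ i ∉ J) ∨ ∃ c, c < s ∧ b c = i + 1
    · obtain ⟨b', J', h', hst, -⟩ := exists_step hi1 h hc
      rw [eRaw_rowF_some hn hs hin h' hst, Option.some_inj] at he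
      exact ⟨b', J', h', he.symm⟩
    · simp [eRaw_rowF_none hn h hc] at he

/-- The hook tableau whose first row lists the minima of the boxes of a one-row set-valued
tableau `t` and whose leg consists of the other entries of `t`. -/
def rowToHook (n s k : ℕ) (t : Filling) : Filling :=
  if h : ∃ p : (ℕ → ℕ) × Finset ℕ, IsHookData n s k p.1 p.2 ∧ t = rowF s p.1 p.2 then
    hookF s (Classical.choose h).1 (Classical.choose h).2
  else t

theorem rowToHook_rowF (hs : 0 < s) (h : IsHookData n s k b J) :
    rowToHook n s k (rowF s b J) = hookF s b J := by
  have hex : ∃ p : (ℕ → ℕ) × Finset ℕ, IsHookData n s k p.1 p.2 ∧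
      rowF s b J = rowF s p.1 p.2 := ⟨(b, J), h, rfl⟩
  have hspec := Classical.choose_spec hex
  obtain ⟨h1, h2⟩ := rowF_injective hs h hspec.1 hspec.2
  rw [rowToHook, dif_pos hex, ← h1, ← h2]

end

/-- For `μ = (s, 1^{k-1})`, the closure of `U_μ` inside `SVT^n((s))` under
all crystal operators is isomorphic, as a crystal, to `SSYT^n(μ) = B(μ)`. -/
theorem single_row_component_iso (n s k : ℕ) (hs : 1 ≤ s) (hk1 : 1 ≤ k) (hkn : k ≤ n) :
    ∃ φ : Filling → Filling,
      (∀ t, Reach n (rowShape s) (Umu s k) t → IsSSYT n (hookShape s (k - 1)) (φ t)) ∧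
      (∀ t t', Reach n (rowShape s) (Umu s k) t → Reach n (rowShape s) (Umu s k) t' →
        φ t = φ t' → t = t') ∧
      (∀ u, IsSSYT n (hookShape s (k - 1)) u →
        ∃ t, Reach n (rowShape s) (Umu s k) t ∧ φ t = u) ∧
      (∀ t, Reach n (rowShape s) (Umu s k) t →
        ∀ j, wt n (hookShape s (k - 1)) (φ t) j = wt n (rowShape s) t j) ∧
      (∀ t, Reach n (rowShape s) (Umu s k) t → ∀ i, 1 ≤ i → i < n →
        (eRaw n (rowShape s) i t = none ↔ eRaw n (hookShape s (k - 1)) i (φ t) = none) ∧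
        (∀ t', eRaw n (rowShape s) i t = some t' →
          eRaw n (hookShape s (k - 1)) i (φ t) = some (φ t')) ∧
        (fRaw n (rowShape s) i t = none ↔ fRaw n (hookShape s (k - 1)) i (φ t) = none) ∧
        (∀ t', fRaw n (rowShape s) i t = some t' →
          fRaw n (hookShape s (k - 1)) i (φ t) = some (φ t'))) := by
  have hn : 0 < n := by omega
  refine ⟨rowToHook n s k, fun t ht => ?_, fun t t' ht ht' he => ?_, fun u hu => ?_,
    fun t ht j => ?_, fun t ht i hi1 hin => ?_⟩
  · obtain ⟨b, J, h, rfl⟩ := ht.exists_rowF hk1 hkn hs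
    rw [rowToHook_rowF hs h]
    exact isSSYT_hookF h
  · obtain ⟨b, J, h, rfl⟩ := ht.exists_rowF hk1 hkn hs
    obtain ⟨b', J', h', rfl⟩ := ht'.exists_rowF hk1 hkn hs
    rw [rowToHook_rowF hs h, rowToHook_rowF hs h'] at he
    obtain ⟨rfl, rfl⟩ := hookF_injective h h' he
    rfl
  · obtain ⟨b, J, h, rfl⟩ := exists_eq_hookF hk1 hs hu
    exact ⟨_, reach_rowF hk1 hn hs h, rowToHook_rowF hs h⟩
  · obtain ⟨b, J, h, rfl⟩ := ht.exists_rowF hk1 hkn hs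
    rw [rowToHook_rowF hs h, wt_rowF hn hs h, wt_hookF hkn hs h]
  · obtain ⟨b, J, h, rfl⟩ := ht.exists_rowF hk1 hkn hs
    rw [rowToHook_rowF hs h, ← and_assoc]
    constructor
    · by_cases hc : (i + 1 ∈ J ∧ (∀ c, c < s → b c ≠ i) ∧ i ∉ J) ∨ ∃ c, c < s ∧ b c = i + 1
      · obtain ⟨b', J', h', hst, -⟩ := exists_step hi1 h hc
        rw [eRaw_rowF_some hn hs hin h' hst, eRaw_hookF_some hkn hs hin h' hst]
        simp [rowToHook_rowF hs h']
      · simp [eRaw_rowF_none hn h hc, eRaw_hookF_none hkn hs h hc]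
    · by_cases hst : ∃ b' J', Step s i b J b' J'
      · obtain ⟨b', J', hst⟩ := hst
        rw [fRaw_rowF_some hn hs h hst, fRaw_hookF_some hkn hs h hst]
        simp [rowToHook_rowF hs (hst.isHookData hin h)]
      · simp [fRaw_rowF_none hn h hst, fRaw_hookF_none hkn hs h hst]

end SVTCrystal

end
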